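/- Let n be a nonnegative integer and let a, b, c ∈ ℂ satisfy a + (b−1)n ≠ 0, 1+c−bn+j ≠ 0 for 0 ≤ j ≤ n−1, and, for all 0 ≤ j ≤ ⌊n/3⌋, (b−1)n−c+j ≠ 0, (c+2−bn)/2+j ≠ 0 and (c+1−bn)/2+j ≠ 0. Then (a/(a+(b−1)n)) · (1−a−bn)_n/((1+c−bn)_n) = Σ_{0 ≤ 3k ≤ n} C(n,3k) 2^{−2k} ((c+1+2k−3bk)/2) (a+c+1−k)_{3k} / (((b−1)n−c)_k ((c+2−bn)/2)_k ((c+1−bn)/2)_{k+1}) − Σ_{0 ≤ 3k+1 ≤ n} C(n,3k+1) 2^{−(2k+1)} ((c+2−b+2k−3bk)/2) (a+c+1−k)_{3k+1} / (((b−1)n−c)_k ((c+2−bn)/2)_{k+1} ((c+1−bn)/2)_{k+1}) + Σ_{0 ≤ 3k+2 ≤ n} C(n,3k+2) 2^{−(2k+2)} (3bk+2b−c−2−2k) (a+c+1−k)_{3k+2} / (((b−1)n−c)_{k+1} ((c+2−bn)/2)_{k+1} ((c+1−bn)/2)_{k+1}). (Second-type reciprocal relation obtained from the Hagen–Rothe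 convolution identity by triplicate inversion.) -/

import Mathlib

/-- Rising factorial (Pochhammer symbol) of a complex number:
`poch x 0 = 1` and `poch x (m+1) = poch x m * (x + m)`. -/
noncomputable def poch (x : ℂ) : ℕ → ℂ
  | 0 => 1
  | m + 1 => poch x m * (x + (m : ℂ))
lemma poch_zero (x : ℂ) : poch x 0 = 1 := rfl

lemma poch_succ (x : ℂ) (m : ℕ) : poch x (m + 1) = poch x m * (x + (m : ℂ)) := rfl

lemma poch_add (x : ℂ) (i j : ℕ) : poch x (i + j) = poch x i * poch (x + i) j := by
  induction j with
  | zero => simp [poch_zero]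
  | succ j ih =>
    rw [← add_assoc, poch_succ, ih, poch_succ]
    push_cast
    ring

lemma poch_succ_left (x : ℂ) (m : ℕ) : poch x (m + 1) = x * poch (x + 1) m := by
  rw [add_comm m 1, poch_add]
  simp [poch]

lemma poch_ne_zero (x : ℂ) (m : ℕ) (h : ∀ j : ℕ, j < m → x + (j : ℂ) ≠ 0) : poch x m ≠ 0 := by
  induction m with
  | zero => simp [poch_zero]
  | succ m ih =>
    rw [poch_succ]
    exact mul_ne_zero (ih fun j hj => h j (by omega)) (h m (by omega))

/-- backward difference of the rising factorial -/
lemma poch_diff (y : ℂ) (M : ℕ) : poch (y + 1) (M + 1) - (M + 1) * poch (y + 1) M = poch y (M + 1) := by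
  rw [poch_succ_left y, poch_succ]
  ring

/-- weights -/
noncomputable def wt (N : ℕ) (d r : ℂ) (m : ℕ) : ℂ :=
  (N.descFactorial m : ℂ) * poch (d + r) (N - m)

lemma wt_zero (N : ℕ) (d r : ℂ) (m : ℕ) (h : N < m) : wt N d r m = 0 := by
  simp [wt, Nat.descFactorial_of_lt h]

lemma wt_diff (N : ℕ) (d r : ℂ) (m : ℕ) :
    wt N d (r + 1) m = wt N d (r + 1) (m + 1) + wt N d r m := by
  rcases lt_trichotomy N m with h | h | h
  · rw [wt_zero _ _ _ _ h, wt_zero _ _ _ _ h, wt_zero _ _ _ _ (by omega)]; simp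
  · subst h
    rw [wt_zero _ _ _ _ (Nat.lt_succ_self N)]
    simp [wt, poch_zero]
  · obtain ⟨M, rfl⟩ : ∃ M, N = m + (M + 1) := ⟨N - m - 1, by omega⟩
    unfold wt
    rw [Nat.descFactorial_succ]
    have e1 : m + (M + 1) - m = M + 1 := by omega
    have e2 : m + (M + 1) - (m + 1) = M := by omega
    rw [e1, e2]
    have := poch_diff (d + r) M
    rw [← add_assoc d r 1]
    push_cast
    linear_combination (((m + (M + 1)).descFactorial m : ℕ) : ℂ) * this

lemma wt_shift (N : ℕ) (d r : ℂ) (m : ℕ) :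
    ((N : ℂ) + 1) * wt N d r m = wt (N + 1) d r (m + 1) := by
  unfold wt
  rw [Nat.succ_descFactorial_succ, Nat.add_sub_add_right]
  push_cast
  ring

/-- The coefficient with index `3k`. -/
noncomputable def uc (x : ℂ) : ℕ → ℂ
  | 0 => 1
  | k + 1 => uc x k * ((x + 1 + 2 * k) * (x + 2 + 2 * k) * (k - x)
      / ((3 * k + 1) * (3 * k + 2) * (3 * k + 3)))

lemma uc_succ (x : ℂ) (k : ℕ) : uc x (k + 1) = uc x k * ((x + 1 + 2 * k) * (x + 2 + 2 * k) * (k - x)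
      / ((3 * k + 1) * (3 * k + 2) * (3 * k + 3))) := rfl

lemma cast_ne (k i : ℕ) (hi : i ≠ 0) : (3 * (k : ℂ) + (i : ℂ)) ≠ 0 := by
  have : (3 * k + i : ℕ) ≠ 0 := by omega
  exact_mod_cast this

lemma uc_shift (x : ℂ) (k : ℕ) : uc (x + 1) (k + 1) = - uc x k *
    ((x + 1 + 2 * k) * (x + 2 + 2 * k) * (x + 3 + 2 * k)
      / ((3 * k + 1) * (3 * k + 2) * (3 * k + 3))) := by
  induction k with
  | zero => simp [uc]; ring
  | succ k ih =>
    rw [uc_succ (x + 1), ih, uc_succ x k]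
    push_cast
    ring

noncomputable def blk (N : ℕ) (x d : ℂ) (k : ℕ) : ℂ :=
  uc x k * wt N d (2 * k + 2) (3 * k)
  - uc x k * ((x + 1 + 2 * k) / (3 * k + 1)) * wt N d (2 * k + 3) (3 * k + 1)
  + uc x k * ((x + 1 + 2 * k) * (x + 2 + 2 * k) / ((3 * k + 1) * (3 * k + 2)))
      * wt N d (2 * k + 3) (3 * k + 2)

lemma blk_zero (N : ℕ) (x d : ℂ) (k : ℕ) (h : N < 3 * k) : blk N x d k = 0 := by
  simp [blk, wt_zero N d _ (3 * k) h, wt_zero N d _ (3 * k + 1) (by omega),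
    wt_zero N d _ (3 * k + 2) (by omega)]

lemma tele (N : ℕ) (x d : ℂ) (K : ℕ) :
    ∑ k ∈ Finset.range (K + 1), (blk (N + 1) (x + 1) d k - blk (N + 1) x d k
      + ((N : ℂ) + 1) * blk N x d k) =
    uc x K * ((x + 1 + 2 * K) * (x + 2 + 2 * K) / ((3 * K + 1) * (3 * K + 2)))
      * wt (N + 1) d (2 * K + 3) (3 * K + 3) := by
  induction K with
  | zero =>
    have s1 := wt_shift N d 2 0
    have s2 := wt_shift N d 3 1
    have s3 := wt_shift N d 3 2
    have r1 := wt_diff (N + 1) d 2 1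
    norm_num at s1 s2 s3 r1
    simp [blk, uc]
    norm_num
    linear_combination s1 - (x + 1) * s2 + (x + 1) * (x + 2) / 2 * s3 - r1
  | succ K ih =>
    rw [Finset.sum_range_succ, ih]
    have s1 := wt_shift N d (2 * (K + 1 : ℕ) + 2) (3 * (K + 1))
    have s2 := wt_shift N d (2 * (K + 1 : ℕ) + 3) (3 * (K + 1) + 1)
    have s3 := wt_shift N d (2 * (K + 1 : ℕ) + 3) (3 * (K + 1) + 2)
    have r1 := wt_diff (N + 1) d (2 * (K + 1 : ℕ) + 2) (3 * (K + 1) + 1)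
    have r2 := wt_diff (N + 1) d (2 * (K + 1 : ℕ) + 1) (3 * (K + 1))
    have e : (2 * (K : ℂ) + 3) = 2 * (K + 1 : ℕ) + 1 := by push_cast; ring
    have e1 : (2 * ((K + 1 : ℕ) : ℂ) + 2 + 1) = 2 * (K + 1 : ℕ) + 3 := by ring
    have e2 : (2 * ((K + 1 : ℕ) : ℂ) + 1 + 1) = 2 * (K + 1 : ℕ) + 2 := by ring
    have e3 : 3 * K + 3 = 3 * (K + 1) := by ring
    rw [e1] at r1
    rw [e2] at r2
    rw [e, e3]
    unfold blk
    have hmul (p q r y1 y2 y3 : ℂ) : ((N : ℂ) + 1) * (p * y1 - q * y2 + r * y3) =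
        p * (((N : ℂ) + 1) * y1) - q * (((N : ℂ) + 1) * y2) + r * (((N : ℂ) + 1) * y3) := by ring
    rw [hmul, s1, s2, s3]
    rw [r2, r1, uc_shift, uc_succ]
    generalize wt (N + 1) d (2 * (K + 1 : ℕ) + 2) (3 * (K + 1) + 1) = B
    generalize wt (N + 1) d (2 * (K + 1 : ℕ) + 3) (3 * (K + 1) + 1 + 1) = A
    generalize wt (N + 1) d (2 * (K + 1 : ℕ) + 1) (3 * (K + 1)) = C
    generalize wt (N + 1) d (2 * (K + 1 : ℕ) + 3) (3 * (K + 1) + 3) = D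
    have h1 := cast_ne K 1 (by norm_num)
    have h2 := cast_ne K 2 (by norm_num)
    have h3 := cast_ne K 3 (by norm_num)
    have h4 := cast_ne K 4 (by norm_num)
    have h5 := cast_ne K 5 (by norm_num)
    push_cast at *
    have h4' : 3 * ((K : ℂ) + 1) + 1 ≠ 0 := by convert h4 using 1; ring
    have h5' : 3 * ((K : ℂ) + 1) + 2 ≠ 0 := by convert h5 using 1; ring
    have h3' : (K : ℂ) + 1 ≠ 0 := by
      intro h; apply h3; linear_combination 3 * h
    field_simp
    ring

def IsPolyFn (f : ℂ → ℂ) : Prop := ∃ p : Polynomial ℂ, ∀ x, f x = p.eval x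

lemma IsPolyFn.const (c : ℂ) : IsPolyFn fun _ => c := ⟨Polynomial.C c, by simp⟩
lemma IsPolyFn.id : IsPolyFn fun x => x := ⟨Polynomial.X, by simp⟩
lemma IsPolyFn.add {f g : ℂ → ℂ} (hf : IsPolyFn f) (hg : IsPolyFn g) : IsPolyFn fun x => f x + g x := by
  obtain ⟨p, hp⟩ := hf
  obtain ⟨q, hq⟩ := hg
  exact ⟨p + q, by simp [hp, hq]⟩
lemma IsPolyFn.sub {f g : ℂ → ℂ} (hf : IsPolyFn f) (hg : IsPolyFn g) : IsPolyFn fun x => f x - g x := by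
  obtain ⟨p, hp⟩ := hf
  obtain ⟨q, hq⟩ := hg
  exact ⟨p - q, by simp [hp, hq]⟩
lemma IsPolyFn.mul {f g : ℂ → ℂ} (hf : IsPolyFn f) (hg : IsPolyFn g) : IsPolyFn fun x => f x * g x := by
  obtain ⟨p, hp⟩ := hf
  obtain ⟨q, hq⟩ := hg
  exact ⟨p * q, by simp [hp, hq]⟩
lemma IsPolyFn.div {f : ℂ → ℂ} (hf : IsPolyFn f) (c : ℂ) : IsPolyFn fun x => f x / c := by
  simp only [div_eq_mul_inv]
  exact hf.mul (IsPolyFn.const _)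
lemma IsPolyFn.sum {f : ℕ → ℂ → ℂ} (hf : ∀ k, IsPolyFn (f k)) (K : ℕ) :
    IsPolyFn fun x => ∑ k ∈ Finset.range K, f k x := by
  choose p hp using hf
  exact ⟨∑ k ∈ Finset.range K, p k, fun x => by simp [Polynomial.eval_finsetSum, hp]⟩

lemma isPoly_poch (d : ℂ) (N : ℕ) : IsPolyFn fun x => poch (d + 1 - x) N := by
  induction N with
  | zero => exact IsPolyFn.const 1
  | succ N ih =>
    simp only [poch_succ]
    exact ih.mul (((IsPolyFn.const _).sub IsPolyFn.id).add (IsPolyFn.const _))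

lemma isPoly_uc (k : ℕ) : IsPolyFn fun x => uc x k := by
  induction k with
  | zero => exact IsPolyFn.const 1
  | succ k ih =>
    simp only [uc_succ]
    have hl (c e : ℂ) : IsPolyFn fun x => x + c + e := (IsPolyFn.id.add (.const c)).add (.const e)
    exact ih.mul ((((hl _ _).mul (hl _ _)).mul ((IsPolyFn.const _).sub IsPolyFn.id)).div _)

lemma isPoly_blk (N : ℕ) (d : ℂ) (k : ℕ) : IsPolyFn fun x => blk N x d k := by
  unfold blk
  have hl (c e : ℂ) : IsPolyFn fun x => x + c + e := (IsPolyFn.id.add (.const c)).add (.const e)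
  have hu := isPoly_uc k
  exact ((hu.mul (.const _)).sub ((hu.mul ((hl _ _).div _)).mul (.const _))).add
    ((hu.mul (((hl _ _).mul (hl _ _)).div _)).mul (.const _))

lemma isPoly_zero {f : ℂ → ℂ} (hf : IsPolyFn f) (h0 : f (-1) = 0) (hs : ∀ x, f (x + 1) = f x) (x : ℂ) :
    f x = 0 := by
  obtain ⟨p, hp⟩ := hf
  have hn : ∀ n : ℕ, f (-1 + n) = 0 := by
    intro n
    induction n with
    | zero => simpa using h0
    | succ n ih => rw [← ih, ← hs (-1 + n)]; push_cast; ring_nf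
  have : p = 0 := by
    apply Polynomial.eq_zero_of_infinite_isRoot
    apply Set.infinite_of_injective_forall_mem (f := fun n : ℕ => (-1 + n : ℂ))
    · intro i j hij
      simpa using hij
    · intro n
      simp only [Set.mem_ofPred_eq, Polynomial.IsRoot, ← hp]
      exact hn n
  rw [hp, this]; simp

lemma uc_neg_one (k : ℕ) : uc (-1) (k + 1) = 0 := by
  induction k with
  | zero => simp [uc]
  | succ k ih => rw [uc_succ, ih]; simp

lemma blk_neg_one (N : ℕ) (d : ℂ) (K : ℕ) :
    ∑ k ∈ Finset.range (K + 1), blk N (-1) d k = poch (d + 2) N := by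
  rw [Finset.sum_range_succ']
  simp [blk, uc_neg_one]
  simp [uc, wt]

theorem key (N : ℕ) (x d : ℂ) (K : ℕ) (hK : N < 3 * (K + 1)) :
    ∑ k ∈ Finset.range (K + 1), blk N x d k = poch (d + 1 - x) N := by
  induction N generalizing x K with
  | zero =>
    rw [Finset.sum_range_succ', Finset.sum_eq_zero]
    · simp [blk, uc, wt, poch]
    · intro k _
      exact blk_zero _ _ _ _ (by omega)
  | succ N ih =>
    have hP : IsPolyFn fun x => ∑ k ∈ Finset.range (K + 1), blk (N + 1) x d k - poch (d + 1 - x) (N + 1) :=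
      (IsPolyFn.sum (isPoly_blk _ _) _).sub (isPoly_poch _ _)
    refine sub_eq_zero.mp (isPoly_zero hP ?_ ?_ x)
    · simp only [blk_neg_one]
      ring_nf
    · intro x
      have ht := tele N x d K
      rw [Finset.sum_add_distrib, Finset.sum_sub_distrib, ← Finset.mul_sum, ih x K (by omega),
        wt_zero _ _ _ _ (by omega), mul_zero] at ht
      have hd := poch_diff (d - x) N
      beta_reduce
      rw [show d + 1 - (x + 1) = d - x by ring]
      rw [show d - x + 1 = d + 1 - x by ring] at hd
      linear_combination ht + hd

lemma poch_fall (d : ℂ) (n f : ℕ) (h : f ≤ n) :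
    (-1) ^ f * poch (-d - n) f * poch (d + 1) (n - f) = poch (d + 1) n := by
  induction f with
  | zero => simp [poch_zero]
  | succ f ih =>
    rw [← ih (by omega), show n - f = (n - (f + 1)) + 1 by omega, poch_succ, poch_succ, pow_succ]
    rw [Nat.cast_sub h]
    push_cast
    ring

lemma poch_dup (d : ℂ) (k : ℕ) :
    poch ((d + 2) / 2) k * poch ((d + 1) / 2) (k + 1) * 2 ^ (2 * k + 1) = poch (d + 1) (2 * k + 1) := by
  induction k with
  | zero => simp [poch]
  | succ k ih =>
    rw [show 2 * (k + 1) + 1 = 2 * k + 1 + 1 + 1 by ring, poch_succ (d + 1), poch_succ (d + 1), ← ih,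
      poch_succ ((d + 2) / 2) k, poch_succ ((d + 1) / 2) (k + 1)]
    push_cast
    ring

lemma poch_dup' (d : ℂ) (k : ℕ) :
    poch ((d + 2) / 2) (k + 1) * poch ((d + 1) / 2) (k + 1) * 2 ^ (2 * k + 2)
      = poch (d + 1) (2 * k + 2) := by
  rw [show 2 * k + 2 = 2 * k + 1 + 1 by ring, poch_succ (d + 1), ← poch_dup, poch_succ ((d + 2) / 2)]
  push_cast
  ring

lemma poch_uc (x : ℂ) (k : ℕ) :
    poch (x + 1 - k) (3 * k) = (-1) ^ k * (Nat.factorial (3 * k) : ℂ) * uc x k := by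
  induction k with
  | zero => simp [poch, uc]
  | succ k ih =>
    rw [show 3 * (k + 1) = 3 * k + 1 + 1 + 1 by ring, poch_succ_left, 
      show x + 1 - ((k + 1 : ℕ) : ℂ) + 1 = x + 1 - k by push_cast; ring, poch_succ, poch_succ, ih,
      Nat.factorial_succ, Nat.factorial_succ, Nat.factorial_succ]
    have h1 := cast_ne k 1 (by norm_num)
    have h2 := cast_ne k 2 (by norm_num)
    have h3 := cast_ne k 3 (by norm_num)
    push_cast at h1 h2 h3
    have hu : uc x (k + 1) * ((3 * k + 1) * (3 * k + 2) * (3 * k + 3)) =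
        uc x k * ((x + 1 + 2 * k) * (x + 2 + 2 * k) * (k - x)) := by
      rw [uc_succ, mul_assoc, div_mul_cancel₀ _ (mul_ne_zero (mul_ne_zero h1 h2) h3)]
    push_cast
    linear_combination (-(-1) ^ (k + 1) * (Nat.factorial (3 * k) : ℂ)) * hu

lemma gen (n m e f : ℕ) (b c d : ℂ) (hef : e + 1 + f = m + 1) (hb : ((n : ℂ) + 1) * b = c - d)
    (hG : m ≤ n + 1 → poch (d + 1) (e + 1) ≠ 0)
    (hF : m ≤ n + 1 → poch (-d - (n + 1 : ℕ)) f ≠ 0) :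
    ((n + 1).choose m : ℂ) * (c + (e + 1) - m * b) /
      (poch (-d - (n + 1 : ℕ)) f * poch (d + 1) (e + 1)) * poch (d + 1) (n + 1) =
    (-1) ^ f * (((n + 1).choose m : ℂ) * poch (d + (e + 1)) (n + 1 - m)
      + (c - d) * ((n.choose m : ℂ) * poch (d + (e + 2)) (n - m))) := by
  by_cases hm : m ≤ n + 1
  swap
  · rw [Nat.choose_eq_zero_of_lt (by omega), Nat.choose_eq_zero_of_lt (by omega)]; simp
  specialize hG hm
  specialize hF hm
  have hW : (-1) ^ f * poch (-d - (n + 1 : ℕ)) f * (poch (d + 1) e * poch (d + (e + 1)) (n + 1 - m))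
      = poch (d + 1) (n + 1) := by
    rw [← poch_fall d (n + 1) f (by omega), show n + 1 - f = e + (n + 1 - m) by omega, poch_add,
      show d + 1 + e = d + (e + 1) by ring]
  have hch : ((n : ℂ) + 1) * n.choose m = ((n : ℂ) + 1 - m) * (n + 1).choose m := by
    have := Nat.add_one_mul_choose_eq n m
    have h2 := Nat.choose_mul_succ_eq n m
    have h3 : (((n + 1 - m : ℕ)) : ℂ) = (n : ℂ) + 1 - m := by
      rw [Nat.cast_sub hm]; push_cast; ring
    rw [← h3]
    have h4 : ((n.choose m * (n + 1) : ℕ) : ℂ) = ((n + 1).choose m * (n + 1 - m) : ℕ) := by rw [h2]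
    push_cast at h4
    linear_combination h4
  have hV : (n.choose m : ℂ) * poch (d + (e + 2)) (n - m) * (d + (e + 1))
      = n.choose m * poch (d + (e + 1)) (n + 1 - m) := by
    by_cases h : m ≤ n
    · rw [show n + 1 - m = n - m + 1 by omega, poch_succ_left,
        show d + ((e : ℂ) + 1) + 1 = d + (e + 2) by ring]
      ring
    · rw [Nat.choose_eq_zero_of_lt (by omega)]; simp
  rw [← hW]
  rw [poch_succ, show d + 1 + (e : ℂ) = d + (e + 1) by ring] at *
  have hE := right_ne_zero_of_mul hG
  have hG' := left_ne_zero_of_mul hG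
  rw [div_mul_eq_mul_div, div_eq_iff (mul_ne_zero hF hG)]
  generalize poch (-d - (n + 1 : ℕ)) f = F at *
  generalize poch (d + 1) e = G at *
  generalize poch (d + (e + 1)) (n + 1 - m) = V at *
  generalize poch (d + (e + 2)) (n - m) = V' at *
  generalize (-1 : ℂ) ^ f = s at *
  linear_combination (-s * F * G * (c - d)) * hV - s * F * G * V * b * hch
    + s * F * G * V * (n.choose m - (n + 1).choose m) * hb

lemma wt_choose (N : ℕ) (d r : ℂ) (m : ℕ) :
    wt N d r m = (Nat.factorial m : ℂ) * ((N.choose m : ℂ) * poch (d + r) (N - m)) := by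
  rw [wt, Nat.descFactorial_eq_factorial_mul_choose]
  push_cast
  ring

lemma sum_ext (f : ℕ → ℂ) (A B : ℕ) (hAB : A ≤ B) (h : ∀ k, A ≤ k → f k = 0) :
    ∑ k ∈ Finset.range A, f k = ∑ k ∈ Finset.range B, f k := by
  apply Finset.sum_subset (Finset.range_subset_range.mpr hAB)
  intro k _ hk
  exact h k (by simpa using hk)

/-- The three terms of the theorem, in terms of `d = c - b n`, `x = a + c`. -/
lemma block_eq (n k : ℕ) (b c d x : ℂ) (hb : ((n : ℂ) + 1) * b = c - d)
    (hbnc : ∀ j : ℕ, j ≤ (n + 1) / 3 → -d - (n + 1 : ℕ) + (j : ℂ) ≠ 0)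
    (h2 : ∀ j : ℕ, j ≤ (n + 1) / 3 → (d + 2) / 2 + (j : ℂ) ≠ 0)
    (h1 : ∀ j : ℕ, j ≤ (n + 1) / 3 → (d + 1) / 2 + (j : ℂ) ≠ 0) :
    (((n + 1).choose (3 * k) : ℂ) * (1 / (2 : ℂ) ^ (2 * k)) *
          ((c + 1 + 2 * (k : ℂ) - 3 * b * (k : ℂ)) / 2) *
          poch (x + 1 - (k : ℂ)) (3 * k) /
          (poch (-d - (n + 1 : ℕ)) k * poch ((d + 2) / 2) k * poch ((d + 1) / 2) (k + 1)) -
      ((n + 1).choose (3 * k + 1) : ℂ) * (1 / (2 : ℂ) ^ (2 * k + 1)) *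
          ((c + 2 - b + 2 * (k : ℂ) - 3 * b * (k : ℂ)) / 2) *
          poch (x + 1 - (k : ℂ)) (3 * k + 1) /
          (poch (-d - (n + 1 : ℕ)) k * poch ((d + 2) / 2) (k + 1) * poch ((d + 1) / 2) (k + 1)) +
      ((n + 1).choose (3 * k + 2) : ℂ) * (1 / (2 : ℂ) ^ (2 * k + 2)) *
          (3 * b * (k : ℂ) + 2 * b - c - 2 - 2 * (k : ℂ)) *
          poch (x + 1 - (k : ℂ)) (3 * k + 2) /
          (poch (-d - (n + 1 : ℕ)) (k + 1) * poch ((d + 2) / 2) (k + 1) *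
            poch ((d + 1) / 2) (k + 1))) * poch (d + 1) (n + 1) =
    blk (n + 1) x (d - 1) k + (c - d) * blk n x d k := by
  have two : ∀ i : ℕ, (2 : ℂ) ^ i ≠ 0 := fun i => pow_ne_zero _ two_ne_zero
  have hd1 : 3 * k ≤ n + 1 → poch (d + 1) (2 * k + 1) ≠ 0 := fun h => by
    rw [← poch_dup]
    exact mul_ne_zero (mul_ne_zero (poch_ne_zero _ _ fun j hj => h2 j (by omega))
      (poch_ne_zero _ _ fun j hj => h1 j (by omega))) (two _)
  have hd2 : 3 * k + 1 ≤ n + 1 → poch (d + 1) (2 * k + 1 + 1) ≠ 0 := fun h => by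
    rw [← poch_dup']
    exact mul_ne_zero (mul_ne_zero (poch_ne_zero _ _ fun j hj => h2 j (by omega))
      (poch_ne_zero _ _ fun j hj => h1 j (by omega))) (two _)
  have g0 := gen n (3 * k) (2 * k) k b c d (by omega) hb hd1
    (fun h => poch_ne_zero _ _ fun j hj => hbnc j (by omega))
  have g1 := gen n (3 * k + 1) (2 * k + 1) k b c d (by omega) hb hd2
    (fun h => poch_ne_zero _ _ fun j hj => hbnc j (by omega))
  have g2 := gen n (3 * k + 2) (2 * k + 1) (k + 1) b c d (by omega) hb (fun h => hd2 (by omega))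
    (fun h => poch_ne_zero _ _ fun j hj => hbnc j (by omega))
  rw [← poch_dup] at g0
  rw [← poch_dup'] at g1 g2
  have c1 := cast_ne k 1 (by norm_num)
  have c2 := cast_ne k 2 (by norm_num)
  push_cast at c1 c2
  have t0 : ((n + 1).choose (3 * k) : ℂ) * (1 / (2 : ℂ) ^ (2 * k)) *
          ((c + 1 + 2 * (k : ℂ) - 3 * b * (k : ℂ)) / 2) *
          poch (x + 1 - (k : ℂ)) (3 * k) /
          (poch (-d - (n + 1 : ℕ)) k * poch ((d + 2) / 2) k * poch ((d + 1) / 2) (k + 1))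
          * poch (d + 1) (n + 1) = uc x k * (wt (n + 1) (d - 1) (2 * k + 2) (3 * k)
            + (c - d) * wt n d (2 * k + 2) (3 * k)) := by
    rw [wt_choose, wt_choose, poch_uc]
    have hs : ((-1 : ℂ) ^ k) * (-1) ^ k = 1 := by rw [← mul_pow]; simp
    have e1 : d - 1 + (2 * (k : ℂ) + 2) = d + (2 * k + 1) := by ring
    rw [e1]
    push_cast at g0 ⊢
    generalize poch (d + (2 * k + 1)) (n + 1 - 3 * k) = V at *
    generalize poch (d + (2 * k + 2)) (n - 3 * k) = V' at *
    rw [show (2 : ℂ) ^ (2 * k + 1) = 2 ^ (2 * k) * 2 from pow_succ _ _] at g0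
    simp only [div_eq_mul_inv, mul_inv, one_mul] at g0 ⊢
    linear_combination ((-1) ^ k * (Nat.factorial (3 * k) : ℂ) * uc x k) * g0
      + ((Nat.factorial (3 * k) : ℂ) * uc x k) * (((n + 1).choose (3 * k) : ℂ) * V
        + (c - d) * ((n.choose (3 * k) : ℂ) * V')) * hs
  have t1 : ((n + 1).choose (3 * k + 1) : ℂ) * (1 / (2 : ℂ) ^ (2 * k + 1)) *
          ((c + 2 - b + 2 * (k : ℂ) - 3 * b * (k : ℂ)) / 2) *
          poch (x + 1 - (k : ℂ)) (3 * k + 1) /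
          (poch (-d - (n + 1 : ℕ)) k * poch ((d + 2) / 2) (k + 1) * poch ((d + 1) / 2) (k + 1))
          * poch (d + 1) (n + 1) = uc x k * ((x + 1 + 2 * k) / (3 * k + 1)) *
           (wt (n + 1) (d - 1) (2 * k + 3) (3 * k + 1)
            + (c - d) * wt n d (2 * k + 3) (3 * k + 1)) := by
    rw [wt_choose, wt_choose, poch_succ, poch_uc, Nat.factorial_succ]
    have hs : ((-1 : ℂ) ^ k) * (-1) ^ k = 1 := by rw [← mul_pow]; simp
    have e1 : d - 1 + (2 * (k : ℂ) + 3) = d + (2 * k + 1 + 1) := by ring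
    have e2 : d + (2 * (k : ℂ) + 3) = d + (2 * k + 1 + 2) := by ring
    rw [e1, e2]
    generalize n + 1 - (3 * k + 1) = M at *
    push_cast at g1 ⊢
    generalize poch (d + (2 * k + 1 + 1)) M = V at *
    generalize poch (d + (2 * k + 1 + 2)) (n - (3 * k + 1)) = V' at *
    have hq : (x + 1 + 2 * (k : ℂ)) / (3 * k + 1) * (3 * k + 1) = x + 1 + 2 * k :=
      div_mul_cancel₀ _ c1
    generalize (x + 1 + 2 * (k : ℂ)) / (3 * k + 1) = q at *
    rw [show (2 : ℂ) ^ (2 * k + 2) = 2 ^ (2 * k + 1) * 2 from pow_succ _ _] at g1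
    simp only [div_eq_mul_inv, mul_inv, one_mul] at g1 ⊢
    linear_combination ((-1) ^ k * (Nat.factorial (3 * k) : ℂ) * uc x k * (x + 1 + 2 * k)) * g1
      + ((Nat.factorial (3 * k) : ℂ) * uc x k * (x + 1 + 2 * k)) *
        (((n + 1).choose (3 * k + 1) : ℂ) * V
        + (c - d) * ((n.choose (3 * k + 1) : ℂ) * V')) * hs
      - ((Nat.factorial (3 * k) : ℂ) * uc x k) *
        (((n + 1).choose (3 * k + 1) : ℂ) * V
        + (c - d) * ((n.choose (3 * k + 1) : ℂ) * V')) * hq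
  have t2 : ((n + 1).choose (3 * k + 2) : ℂ) * (1 / (2 : ℂ) ^ (2 * k + 2)) *
          (3 * b * (k : ℂ) + 2 * b - c - 2 - 2 * (k : ℂ)) *
          poch (x + 1 - (k : ℂ)) (3 * k + 2) /
          (poch (-d - (n + 1 : ℕ)) (k + 1) * poch ((d + 2) / 2) (k + 1) *
            poch ((d + 1) / 2) (k + 1))
          * poch (d + 1) (n + 1) =
          uc x k * ((x + 1 + 2 * k) * (x + 2 + 2 * k) / ((3 * k + 1) * (3 * k + 2))) *
           (wt (n + 1) (d - 1) (2 * k + 3) (3 * k + 2)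
            + (c - d) * wt n d (2 * k + 3) (3 * k + 2)) := by
    rw [wt_choose, wt_choose, poch_succ, poch_succ, poch_uc, Nat.factorial_succ, Nat.factorial_succ]
    have hs : ((-1 : ℂ) ^ k) * (-1) ^ k = 1 := by rw [← mul_pow]; simp
    have e1 : d - 1 + (2 * (k : ℂ) + 3) = d + (2 * k + 1 + 1) := by ring
    have e2 : d + (2 * (k : ℂ) + 3) = d + (2 * k + 1 + 2) := by ring
    rw [e1, e2]
    generalize n + 1 - (3 * k + 2) = M at *
    push_cast at g2 ⊢
    generalize poch (d + (2 * k + 1 + 1)) M = V at *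
    generalize poch (d + (2 * k + 1 + 2)) (n - (3 * k + 2)) = V' at *
    have hq : (x + 1 + 2 * (k : ℂ)) * (x + 2 + 2 * k) / ((3 * k + 1) * (3 * k + 2))
        * ((3 * k + 1) * (3 * k + 2)) = (x + 1 + 2 * k) * (x + 2 + 2 * k) :=
      div_mul_cancel₀ _ (mul_ne_zero c1 c2)
    generalize (x + 1 + 2 * (k : ℂ)) * (x + 2 + 2 * k) / ((3 * k + 1) * (3 * k + 2)) = q at *
    simp only [div_eq_mul_inv, mul_inv, one_mul] at g2 ⊢
    linear_combination
      (-(-1) ^ k * (Nat.factorial (3 * k) : ℂ) * uc x k * ((x + 1 + 2 * k) * (x + 2 + 2 * k))) * g2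
      + ((Nat.factorial (3 * k) : ℂ) * uc x k * ((x + 1 + 2 * k) * (x + 2 + 2 * k))) *
        (((n + 1).choose (3 * k + 2) : ℂ) * V
        + (c - d) * ((n.choose (3 * k + 2) : ℂ) * V')) * hs
      - ((Nat.factorial (3 * k) : ℂ) * uc x k) *
        (((n + 1).choose (3 * k + 2) : ℂ) * V
        + (c - d) * ((n.choose (3 * k + 2) : ℂ) * V')) * hq
  rw [add_mul, sub_mul, t0, t1, t2]
  unfold blk
  ring

/-- Second-type reciprocal relation obtained from the Hagen–Rothe convolution identity
by triplicate inversion. -/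
theorem hr_reciprocal_triplicate (n : ℕ) (a b c : ℂ)
    (habn : a + (b - 1) * (n : ℂ) ≠ 0)
    (hcbn : ∀ j : ℕ, j < n → 1 + c - b * (n : ℂ) + (j : ℂ) ≠ 0)
    (hbnc : ∀ j : ℕ, j ≤ n / 3 → (b - 1) * (n : ℂ) - c + (j : ℂ) ≠ 0)
    (h2 : ∀ j : ℕ, j ≤ n / 3 → (c + 2 - b * (n : ℂ)) / 2 + (j : ℂ) ≠ 0)
    (h1 : ∀ j : ℕ, j ≤ n / 3 → (c + 1 - b * (n : ℂ)) / 2 + (j : ℂ) ≠ 0) :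
    (a / (a + (b - 1) * (n : ℂ))) *
        (poch (1 - a - b * (n : ℂ)) n / poch (1 + c - b * (n : ℂ)) n) =
      (∑ k ∈ Finset.range (n / 3 + 1),
        (n.choose (3 * k) : ℂ) * (1 / (2 : ℂ) ^ (2 * k)) *
          ((c + 1 + 2 * (k : ℂ) - 3 * b * (k : ℂ)) / 2) *
          poch (a + c + 1 - (k : ℂ)) (3 * k) /
          (poch ((b - 1) * (n : ℂ) - c) k * poch ((c + 2 - b * (n : ℂ)) / 2) k *
            poch ((c + 1 - b * (n : ℂ)) / 2) (k + 1))) -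
      (∑ k ∈ Finset.range ((n + 2) / 3),
        (n.choose (3 * k + 1) : ℂ) * (1 / (2 : ℂ) ^ (2 * k + 1)) *
          ((c + 2 - b + 2 * (k : ℂ) - 3 * b * (k : ℂ)) / 2) *
          poch (a + c + 1 - (k : ℂ)) (3 * k + 1) /
          (poch ((b - 1) * (n : ℂ) - c) k * poch ((c + 2 - b * (n : ℂ)) / 2) (k + 1) *
            poch ((c + 1 - b * (n : ℂ)) / 2) (k + 1))) +
      ∑ k ∈ Finset.range ((n + 1) / 3),
        (n.choose (3 * k + 2) : ℂ) * (1 / (2 : ℂ) ^ (2 * k + 2)) *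
          (3 * b * (k : ℂ) + 2 * b - c - 2 - 2 * (k : ℂ)) *
          poch (a + c + 1 - (k : ℂ)) (3 * k + 2) /
          (poch ((b - 1) * (n : ℂ) - c) (k + 1) * poch ((c + 2 - b * (n : ℂ)) / 2) (k + 1) *
            poch ((c + 1 - b * (n : ℂ)) / 2) (k + 1)) := by
  rcases n with _ | n
  · simp only [Nat.cast_zero, mul_zero, add_zero] at habn h1
    have h10 := h1 0 (by simp)
    simp only [sub_zero, Nat.cast_zero, add_zero] at h10
    simp [poch]
    rw [div_self habn, div_self]
    intro h; apply h10; rw [h]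
  set d : ℂ := c - b * ((n + 1 : ℕ) : ℂ) with hd
  have hb : ((n : ℂ) + 1) * b = c - d := by rw [hd]; push_cast; ring
  have e1 : (b - 1) * ((n + 1 : ℕ) : ℂ) - c = -d - (n + 1 : ℕ) := by rw [hd]; ring
  have e2 : c + 2 - b * ((n + 1 : ℕ) : ℂ) = d + 2 := by rw [hd]; ring
  have e3 : c + 1 - b * ((n + 1 : ℕ) : ℂ) = d + 1 := by rw [hd]; ring
  have e4 : 1 + c - b * ((n + 1 : ℕ) : ℂ) = d + 1 := by rw [hd]; ring
  have e5 : 1 - a - b * ((n + 1 : ℕ) : ℂ) = d + 1 - (a + c) := by rw [hd]; ring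
  rw [e1] at hbnc
  rw [e2] at h2
  rw [e3] at h1
  rw [e4] at hcbn
  rw [e1, e2, e3, e4, e5]
  have hW : poch (d + 1) (n + 1) ≠ 0 := poch_ne_zero _ _ hcbn
  rw [sum_ext _ ((n + 1 + 2) / 3) ((n + 1) / 3 + 1) (by omega) (fun k hk => by
      rw [Nat.choose_eq_zero_of_lt (by omega)]; simp),
    sum_ext _ ((n + 1 + 1) / 3) ((n + 1) / 3 + 1) (by omega) (fun k hk => by
      rw [Nat.choose_eq_zero_of_lt (by omega)]; simp),
    ← Finset.sum_sub_distrib, ← Finset.sum_add_distrib]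
  apply mul_right_cancel₀ hW
  rw [Finset.sum_mul, Finset.sum_congr rfl
    (fun k _ => block_eq n k b c d (a + c) hb hbnc h2 h1), Finset.sum_add_distrib, ← Finset.mul_sum,
    key _ _ _ _ (by omega), key _ _ _ _ (by omega), mul_assoc, div_mul_cancel₀ _ hW,
    poch_succ, poch_succ_left]
  have e6 : d + 1 - (a + c) + (n : ℂ) = -(a + (b - 1) * ((n + 1 : ℕ) : ℂ)) := by
    rw [hd]; push_cast; ring
  rw [e6, show d - 1 + 1 - (a + c) + 1 = d + 1 - (a + c) by ring]
  field_simp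
  ring
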